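/- Let T = ℝ²/Λ be a flat torus (Λ a lattice in ℝ²) and suppose T contains n pairwise disjoint embedded open metric disks, each of radius r > 0. Then the area of T is at least n · π r² · (√12 / π), i.e., Area(T) ≥ n · √12 · r². -/

import Mathlib

open MeasureTheory Metric

namespace TorusPacking

lemma sector_vol (β R : ℝ) (hβ : 0 < β) (hβ2 : β < Real.pi) (hR : 0 < R) :
    volume {z : ℂ | ‖z‖ < R ∧ Real.cos β * ‖z‖ < z.re} = ENNReal.ofReal (β * R ^ 2) := by
  have hm : MeasurableSet {z : ℂ | ‖z‖ < R ∧ Real.cos β * ‖z‖ < z.re} := by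
    apply MeasurableSet.inter
    · exact measurableSet_lt measurable_norm measurable_const
    · exact measurableSet_lt (measurable_norm.const_mul _) Complex.measurable_re
  rw [← lintegral_indicator_one hm, ← Complex.lintegral_comp_polarCoord_symm]
  have h1 : ∀ p ∈ polarCoord.target, ENNReal.ofReal p.1 •
      ({z : ℂ | ‖z‖ < R ∧ Real.cos β * ‖z‖ < z.re}.indicator (1 : ℂ → ENNReal)
        (Complex.polarCoord.symm p)) =
      (Set.Ioo 0 R ×ˢ Set.Ioo (-β) β).indicator (fun p : ℝ × ℝ => ENNReal.ofReal p.1) p := by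
    rintro ⟨s, φ⟩ hp
    simp only [polarCoord_target, Set.mem_prod, Set.mem_Ioi, Set.mem_Ioo] at hp
    obtain ⟨hs, hφ1, hφ2⟩ := hp
    have key : Real.cos β < Real.cos φ ↔ -β < φ ∧ φ < β := by
      rw [← abs_lt, ← Real.cos_abs φ]
      exact Real.strictAntiOn_cos.lt_iff_gt ⟨hβ.le, hβ2.le⟩ ⟨abs_nonneg _, (abs_lt.2 ⟨hφ1, hφ2⟩).le⟩
    have hre : (Complex.polarCoord.symm (s, φ)).re = s * Real.cos φ := by
      rw [Complex.polarCoord_symm_apply]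
      simp [Complex.cos_ofReal_re, Complex.sin_ofReal_im]
    have hmem : (Complex.polarCoord.symm (s, φ)) ∈ {z : ℂ | ‖z‖ < R ∧ Real.cos β * ‖z‖ < z.re} ↔
        (s, φ) ∈ Set.Ioo 0 R ×ˢ Set.Ioo (-β) β := by
      simp only [Set.mem_ofPred_eq, Complex.norm_polarCoord_symm, hre, abs_of_pos hs,
        Set.mem_prod, Set.mem_Ioo, ← key, hs, true_and]
      rw [mul_comm, mul_lt_mul_iff_right₀ hs]
    by_cases hc : (s, φ) ∈ Set.Ioo 0 R ×ˢ Set.Ioo (-β) β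
    · rw [Set.indicator_of_mem hc, Set.indicator_of_mem (hmem.2 hc)]; simp
    · rw [Set.indicator_of_notMem hc, Set.indicator_of_notMem (fun h => hc (hmem.1 h))]; simp
  rw [setLIntegral_congr_fun polarCoord.open_target.measurableSet h1,
    setLIntegral_indicator (measurableSet_Ioo.prod measurableSet_Ioo)]
  have h2 : (Set.Ioo 0 R ×ˢ Set.Ioo (-β) β) ∩ polarCoord.target = Set.Ioo 0 R ×ˢ Set.Ioo (-β) β := by
    apply Set.inter_eq_left.2
    rintro ⟨s, φ⟩ ⟨⟨h1, h2⟩, h3, h4⟩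
    simp only [polarCoord_target, Set.mem_prod, Set.mem_Ioi, Set.mem_Ioo]
    dsimp at *
    exact ⟨h1, by linarith, by linarith⟩
  rw [h2, Measure.volume_eq_prod, ← Measure.prod_restrict, lintegral_prod _ (by fun_prop)]
  simp only [lintegral_const, Measure.restrict_apply MeasurableSet.univ, Set.univ_inter, Real.volume_Ioo]
  rw [lintegral_mul_const _ (by fun_prop), ← ofReal_integral_eq_lintegral_ofReal]
  · rw [← integral_Ioc_eq_integral_Ioo, ← intervalIntegral.integral_of_le hR.le, integral_id,
      ← ENNReal.ofReal_mul (by nlinarith [sq_nonneg R])]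
    congr 1; ring
  · exact (continuous_id.integrableOn_Icc (a := 0) (b := R)).mono_set Set.Ioo_subset_Icc_self
  · filter_upwards [ae_restrict_mem measurableSet_Ioo] with x hx using hx.1.le

lemma tri_vol (h t : ℝ) (hh : 0 < h) (ht : 0 < t) :
    volume {z : ℂ | (0 < z.re ∧ z.re < h) ∧ -(t * z.re) < z.im ∧ z.im < t * z.re}
      = ENNReal.ofReal (t * h ^ 2) := by
  have : {z : ℂ | (0 < z.re ∧ z.re < h) ∧ -(t * z.re) < z.im ∧ z.im < t * z.re} =
      Complex.measurableEquivRealProd ⁻¹'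
        (regionBetween (fun x => -(t * x)) (fun x => t * x) (Set.Ioo 0 h)) := by
    ext z
    simp [regionBetween, Complex.measurableEquivRealProd_apply]
  rw [this, Complex.volume_preserving_equiv_real_prod.measure_preimage
    (measurableSet_regionBetween (by fun_prop) (by fun_prop) measurableSet_Ioo).nullMeasurableSet,
    Measure.volume_eq_prod, volume_regionBetween_eq_integral]
  · rw [← integral_Ioc_eq_integral_Ioo, ← intervalIntegral.integral_of_le hh.le]
    have : ∀ y : ℝ, ((fun x => t * x) - (fun x => -(t * x))) y = (2 * t) * y := by
      intro y; simp; ring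
    simp only [this]
    rw [intervalIntegral.integral_const_mul, integral_id]
    congr 1; ring
  · exact (Continuous.integrableOn_Icc (by fun_prop)).mono_set Set.Ioo_subset_Icc_self
  · exact (Continuous.integrableOn_Icc (by fun_prop)).mono_set Set.Ioo_subset_Icc_self
  · exact measurableSet_Ioo
  · intro x hx
    have := mul_pos ht hx.1
    linarith

noncomputable def κ : ℝ := 3 * Real.sqrt 3 / (2 * Real.pi)

lemma kappa_pos : 0 < κ := by unfold κ; positivity

lemma kappa_lt : κ < 1 := by
  unfold κ
  rw [div_lt_one (by positivity)]
  have : Real.sqrt 3 < 2 := by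
    rw [Real.sqrt_lt' (by norm_num)]; norm_num
  linarith [Real.pi_gt_three]

lemma sin_ineq (β : ℝ) (h0 : 0 < β) (h1 : β ≤ Real.pi / 6) :
    κ * β ≤ Real.sin β * Real.cos β := by
  have hπ := Real.pi_pos
  have h := strictConcaveOn_sin_Icc.concaveOn.2 (Set.mem_Icc.2 ⟨le_refl (0 : ℝ), hπ.le⟩)
    (Set.mem_Icc.2 ⟨(by positivity : 0 ≤ Real.pi / 3), by linarith⟩)
    (by rw [sub_nonneg, div_le_one hπ]; linarith : 0 ≤ 1 - 6 * β / Real.pi)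
    (by positivity : 0 ≤ 6 * β / Real.pi) (by ring)
  simp only [smul_eq_mul, mul_zero, zero_add, Real.sin_zero, Real.sin_pi_div_three] at h
  have e : 6 * β / Real.pi * (Real.pi / 3) = 2 * β := by field_simp; ring
  rw [e, Real.sin_two_mul] at h
  have e2 : 6 * β / Real.pi * (Real.sqrt 3 / 2) = 2 * (κ * β) := by unfold κ; field_simp; ring
  linarith

lemma cap_C (R h : ℝ) (hR : 0 < R) (h1 : Real.sqrt 3 / 2 * R ≤ h) (h2 : h < R) :
    volume {z : ℂ | ‖z‖ < R ∧ h ≤ z.re} ≤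
      ENNReal.ofReal (1 - κ) * volume {z : ℂ | ‖z‖ < R ∧ h * ‖z‖ < R * z.re} := by
  have hh : 0 < h := lt_of_lt_of_le (by positivity) h1
  obtain ⟨β, hβ⟩ : ∃ β, β = Real.arccos (h / R) := ⟨_, rfl⟩
  have hq : h / R < 1 := by rw [div_lt_one hR]; exact h2
  have hq0 : 0 < h / R := by positivity
  have hc : Real.cos β = h / R := by
    rw [hβ, Real.cos_arccos (by linarith) hq.le]
  have hβ0 : 0 < β := by rw [hβ]; exact Real.arccos_pos.2 hq
  have hβ1 : β ≤ Real.pi / 6 := by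
    have : Real.arccos (Real.cos (Real.pi / 6)) = Real.pi / 6 :=
      Real.arccos_cos (by positivity) (by linarith [Real.pi_pos])
    rw [hβ, ← this, Real.cos_pi_div_six]
    apply Real.arccos_le_arccos
    rw [le_div_iff₀ hR]; exact h1
  have hπ := Real.pi_pos
  have hS : {z : ℂ | ‖z‖ < R ∧ h * ‖z‖ < R * z.re} = {z : ℂ | ‖z‖ < R ∧ Real.cos β * ‖z‖ < z.re} := by
    ext z
    simp only [Set.mem_ofPred_eq, hc]
    rw [div_mul_eq_mul_div, div_lt_iff₀ hR, mul_comm R]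
  have hSv := sector_vol β R hβ0 (by linarith) hR
  have hcpos : 0 < Real.cos β := by rw [hc]; exact hq0
  have hspos : 0 < Real.sin β := Real.sin_pos_of_pos_of_lt_pi hβ0 (by linarith)
  have htan : 0 < Real.tan β := by rw [Real.tan_eq_sin_div_cos]; positivity
  have hTv := tri_vol h (Real.tan β) hh htan
  rw [hS]
  set S := {z : ℂ | ‖z‖ < R ∧ Real.cos β * ‖z‖ < z.re}
  set T := {z : ℂ | (0 < z.re ∧ z.re < h) ∧ -(Real.tan β * z.re) < z.im ∧ z.im < Real.tan β * z.re}
  have hmC : MeasurableSet {z : ℂ | ‖z‖ < R ∧ h ≤ z.re} := by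
    apply MeasurableSet.inter
    · exact measurableSet_lt measurable_norm measurable_const
    · exact measurableSet_le measurable_const Complex.measurable_re
  have hd : Disjoint {z : ℂ | ‖z‖ < R ∧ h ≤ z.re} T := by
    rw [Set.disjoint_left]
    rintro z ⟨_, hz⟩ ⟨⟨_, hz'⟩, _⟩
    linarith
  have hsub : {z : ℂ | ‖z‖ < R ∧ h ≤ z.re} ∪ T ⊆ S := by
    rintro z (⟨ha, hb⟩ | ⟨⟨ha, hb⟩, hi⟩)
    · refine ⟨ha, ?_⟩
      rw [hc, div_mul_eq_mul_div, div_lt_iff₀ hR]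
      nlinarith
    · have hlt : Real.cos β * ‖z‖ < z.re := by
        apply lt_of_pow_lt_pow_left₀ 2 ha.le
        rw [mul_pow, Complex.sq_norm, Complex.normSq_apply]
        have him : (Real.cos β * z.im) ^ 2 < (Real.sin β * z.re) ^ 2 := by
          apply sq_lt_sq'
          · have := mul_lt_mul_of_pos_left hi.1 hcpos
            rw [Real.tan_eq_sin_div_cos] at this
            field_simp at this
            linarith
          · have := mul_lt_mul_of_pos_left hi.2 hcpos
            rw [Real.tan_eq_sin_div_cos] at this
            field_simp at this
            linarith
        nlinarith [Real.sin_sq_add_cos_sq β]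
      refine ⟨?_, hlt⟩
      have : Real.cos β * ‖z‖ < Real.cos β * R := by
        rw [hc, div_mul_cancel₀ _ hR.ne', ← hc]; linarith
      exact lt_of_mul_lt_mul_left this hcpos.le
  have hle := measure_mono (μ := volume) hsub
  rw [measure_union' hd hmC] at hle
  have hTS : ENNReal.ofReal κ * volume S ≤ volume T := by
    rw [hSv, hTv, ← ENNReal.ofReal_mul kappa_pos.le]
    apply ENNReal.ofReal_le_ofReal
    have e : Real.tan β * h ^ 2 = Real.sin β * Real.cos β * R ^ 2 := by
      have : h = Real.cos β * R := by rw [hc]; field_simp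
      rw [this, Real.tan_eq_sin_div_cos]; field_simp
    rw [e, ← mul_assoc]
    exact mul_le_mul_of_nonneg_right (sin_ineq β hβ0 hβ1) (by positivity)
  have hfin : ENNReal.ofReal κ * volume S ≠ ⊤ := by
    rw [hSv]; exact ENNReal.mul_ne_top ENNReal.ofReal_ne_top ENNReal.ofReal_ne_top
  refine (ENNReal.add_le_add_iff_right hfin).1 ?_
  calc _ ≤ _ := add_le_add le_rfl hTS
    _ ≤ _ := hle
    _ = _ := by
      rw [← add_mul, ← ENNReal.ofReal_add (by linarith [kappa_lt]) kappa_pos.le]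
      simp

abbrev E2 := EuclideanSpace ℝ (Fin 2)

lemma exists_rot (p : E2) : ∃ f : E2 ≃ₗᵢ[ℝ] ℂ, f p = (‖p‖ : ℂ) := by
  let g := Complex.orthonormalBasisOneI.repr.symm
  have hn : ‖g p‖ = ‖p‖ := g.norm_map p
  refine ⟨g.trans (rotation (Circle.exp (Complex.arg (g p)))⁻¹), ?_⟩
  rw [LinearIsometryEquiv.trans_apply, rotation_apply, Circle.coe_inv, Circle.coe_exp, ← hn]
  have := Complex.exp_ne_zero (Complex.arg (g p) * Complex.I)
  rw [inv_mul_eq_iff_eq_mul₀ this, mul_comm]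
  exact (Complex.norm_mul_exp_arg_mul_I (g p)).symm

lemma cap_E (R : ℝ) (p : E2) (hR : 0 < R) (h1 : Real.sqrt 3 * R ≤ ‖p‖) :
    volume {x : E2 | ‖x‖ < R ∧ ‖x - p‖ ≤ ‖x‖} ≤
      ENNReal.ofReal (1 - κ) * volume {x : E2 | ‖x‖ < R ∧ ‖p‖ ^ 2 * ‖x‖ < 2 * R * inner ℝ x p} := by
  have hp : 0 < ‖p‖ := lt_of_lt_of_le (by positivity) h1
  obtain ⟨f, hf⟩ := exists_rot p
  have hin : ∀ x, inner ℝ x p = ‖p‖ * (f x).re := by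
    intro x
    rw [← f.inner_map_map, hf, Complex.inner]
    simp; try ring
  have hcap : ∀ x : E2, ‖x - p‖ ≤ ‖x‖ ↔ ‖p‖ / 2 ≤ (f x).re := by
    intro x
    rw [← sq_le_sq₀ (norm_nonneg _) (norm_nonneg _), norm_sub_sq_real, hin]
    constructor <;> intro h <;> nlinarith
  by_cases h2 : ‖p‖ / 2 < R
  · have := cap_C R (‖p‖ / 2) hR (by linarith) h2
    have e1 : {x : E2 | ‖x‖ < R ∧ ‖x - p‖ ≤ ‖x‖} = f ⁻¹' {z : ℂ | ‖z‖ < R ∧ ‖p‖ / 2 ≤ z.re} := by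
      ext x; simp [hcap]
    have e2 : {x : E2 | ‖x‖ < R ∧ ‖p‖ ^ 2 * ‖x‖ < 2 * R * inner ℝ x p} =
        f ⁻¹' {z : ℂ | ‖z‖ < R ∧ ‖p‖ / 2 * ‖z‖ < R * z.re} := by
      ext x
      simp only [Set.mem_ofPred_eq, Set.mem_preimage, f.norm_map, hin]
      refine and_congr_right fun _ => ?_
      rw [show ‖p‖ ^ 2 * ‖x‖ = (2 * ‖p‖) * (‖p‖ / 2 * ‖x‖) by ring,
        show 2 * R * (‖p‖ * (f x).re) = (2 * ‖p‖) * (R * (f x).re) by ring]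
      exact mul_lt_mul_iff_right₀ (by positivity)
    rw [e1, e2]
    have hmp : ∀ s, volume (f ⁻¹' s) = volume s := fun s =>
      f.measurePreserving.measure_preimage_equiv (f := f.toMeasurableEquiv) s
    rw [hmp, hmp]
    exact this
  · have : {x : E2 | ‖x‖ < R ∧ ‖x - p‖ ≤ ‖x‖} = ∅ := by
      ext x
      simp only [Set.mem_ofPred_eq, Set.mem_empty_iff_false, iff_false, not_and, hcap]
      intro hx h
      have := Complex.re_le_norm (f x)
      rw [f.norm_map] at this
      linarith
    rw [this]; simp

lemma sectors_disjoint (R : ℝ) (hR : 0 < R) (p q : E2) (hp : Real.sqrt 3 * R ≤ ‖p‖)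
    (hq : Real.sqrt 3 * R ≤ ‖q‖) (hpq : Real.sqrt 3 * R ≤ ‖p - q‖) :
    Disjoint {x : E2 | ‖x‖ < R ∧ ‖p‖ ^ 2 * ‖x‖ < 2 * R * inner ℝ x p}
      {x : E2 | ‖x‖ < R ∧ ‖q‖ ^ 2 * ‖x‖ < 2 * R * inner ℝ x q} := by
  rw [Set.disjoint_left]
  rintro x ⟨_, h1⟩ ⟨_, h2⟩
  have hx : 0 < ‖x‖ := by
    rw [norm_pos_iff]; rintro rfl; simp at h1
  obtain ⟨y, hy⟩ : ∃ y : E2, y = (R / ‖x‖) • x := ⟨_, rfl⟩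
  have hyn : ‖y‖ = R := by
    rw [hy, norm_smul, Real.norm_of_nonneg (by positivity)]; field_simp
  have hyi : ∀ w : E2, ‖w‖ ^ 2 * ‖x‖ < 2 * R * inner ℝ x w → ‖w‖ ^ 2 < 2 * inner ℝ y w := by
    intro w hw
    rw [hy, real_inner_smul_left]
    have := mul_lt_mul_of_pos_right hw (inv_pos.2 hx)
    field_simp at this ⊢
    linarith
  have a1 := hyi p h1
  have a2 := hyi q h2
  have sq3 : ∀ w : E2, Real.sqrt 3 * R ≤ ‖w‖ → 3 * R ^ 2 ≤ ‖w‖ ^ 2 := by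
    intro w hw
    have := pow_le_pow_left₀ (by positivity) hw 2
    rwa [mul_pow, Real.sq_sqrt (by norm_num)] at this
  have b1 := sq3 p hp
  have b2 := sq3 q hq
  have b3 := sq3 _ hpq
  have e : 0 ≤ ‖p + q - (3 : ℝ) • y‖ ^ 2 := by positivity
  rw [norm_sub_sq_real, norm_add_sq_real, inner_smul_right, inner_add_left, norm_smul, hyn,
    real_inner_comm y p, real_inner_comm y q] at e
  rw [norm_sub_sq_real] at b3
  norm_num at e
  nlinarith

lemma cell {ι : Type*} [Countable ι] (r : ℝ) (hr : 0 < r) (p : ι → E2)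
    (hp : ∀ i, 2 * r ≤ ‖p i‖) (hpq : ∀ i j, i ≠ j → 2 * r ≤ ‖p i - p j‖) :
    ENNReal.ofReal (Real.sqrt 12 * r ^ 2) ≤ volume {x : E2 | ∀ i, ‖x‖ < ‖x - p i‖} := by
  obtain ⟨R, hRr⟩ : ∃ R, R = 2 * r / Real.sqrt 3 := ⟨_, rfl⟩
  have hR : 0 < R := by rw [hRr]; positivity
  have hR2 : Real.sqrt 3 * R = 2 * r := by rw [hRr]; field_simp
  set C : ι → Set E2 := fun i => {x : E2 | ‖x‖ < R ∧ ‖x - p i‖ ≤ ‖x‖}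
  set S : ι → Set E2 := fun i => {x : E2 | ‖x‖ < R ∧ ‖p i‖ ^ 2 * ‖x‖ < 2 * R * inner ℝ x (p i)}
  have hSm : ∀ i, MeasurableSet (S i) := by
    intro i
    apply MeasurableSet.inter
    · exact measurableSet_lt measurable_norm measurable_const
    · exact (isOpen_lt (f := fun x : E2 => ‖p i‖ ^ 2 * ‖x‖) (g := fun x : E2 => 2 * R * inner ℝ x (p i))
        (by fun_prop) (by fun_prop)).measurableSet
  have hSd : Pairwise (Function.onFun Disjoint S) := by
    intro i j hij
    exact sectors_disjoint R hR _ _ (by rw [hR2]; exact hp i) (by rw [hR2]; exact hp j)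
      (by rw [hR2]; exact hpq i j hij)
  have hball : ball (0 : E2) R ⊆ {x : E2 | ∀ i, ‖x‖ < ‖x - p i‖} ∪ ⋃ i, C i := by
    intro x hx
    rw [mem_ball_zero_iff] at hx
    by_cases h : ∀ i, ‖x‖ < ‖x - p i‖
    · exact Or.inl h
    · push Not at h
      obtain ⟨i, hi⟩ := h
      exact Or.inr (Set.mem_iUnion.2 ⟨i, hx, hi⟩)
  have hU : volume (⋃ i, C i) ≤ ENNReal.ofReal (1 - κ) * volume (ball (0 : E2) R) := by
    calc volume (⋃ i, C i) ≤ ∑' i, volume (C i) := measure_iUnion_le _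
      _ ≤ ∑' i, ENNReal.ofReal (1 - κ) * volume (S i) :=
        ENNReal.tsum_le_tsum fun i => cap_E R (p i) hR (by rw [hR2]; exact hp i)
      _ = ENNReal.ofReal (1 - κ) * volume (⋃ i, S i) := by
        rw [ENNReal.tsum_mul_left, measure_iUnion hSd hSm]
      _ ≤ _ := by
        gcongr
        apply Set.iUnion_subset
        intro i x hx
        rw [mem_ball_zero_iff]; exact hx.1
  have hfin : ENNReal.ofReal (1 - κ) * volume (ball (0 : E2) R) ≠ ⊤ :=
    ENNReal.mul_ne_top ENNReal.ofReal_ne_top measure_ball_lt_top.ne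
  have hv : ENNReal.ofReal κ * volume (ball (0 : E2) R) = ENNReal.ofReal (Real.sqrt 12 * r ^ 2) := by
    have : volume (ball (0 : E2) R) = ENNReal.ofReal (R ^ 2 * Real.pi) := by
      rw [EuclideanSpace.volume_ball_fin_two, ENNReal.ofReal_mul (by positivity),
        ENNReal.ofReal_pow hR.le]
      try simp [NNReal.pi, ENNReal.ofReal]
    rw [this, ← ENNReal.ofReal_mul kappa_pos.le]
    congr 1
    have h12 : Real.sqrt 12 = 2 * Real.sqrt 3 := by
      rw [show (12 : ℝ) = 2 ^ 2 * 3 by norm_num, Real.sqrt_mul (by norm_num),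
        Real.sqrt_sq (by norm_num)]
    have h3 : Real.sqrt 3 ^ 2 = 3 := Real.sq_sqrt (by norm_num)
    have hRsq : R ^ 2 = 4 * r ^ 2 / 3 := by rw [hRr, div_pow, h3]; ring
    rw [hRsq, h12]
    unfold κ
    field_simp
    ring
  rw [← hv]
  refine (ENNReal.add_le_add_iff_right hfin).1 ?_
  calc _ = volume (ball (0 : E2) R) := by
        rw [← add_mul, ← ENNReal.ofReal_add kappa_pos.le (by linarith [kappa_lt])]
        simp
    _ ≤ _ := measure_mono hball
    _ ≤ _ := measure_union_le _ _
    _ ≤ _ := add_le_add le_rfl hU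

end TorusPacking

open TorusPacking in
theorem torus_circle_packing (Λ : Submodule ℤ (EuclideanSpace ℝ (Fin 2)))
    [DiscreteTopology Λ] [IsZLattice ℝ Λ] (n : ℕ) (r : ℝ) (hr : 0 < r)
    (c : Fin n → EuclideanSpace ℝ (Fin 2))
    (hdisj : ∀ (i j : Fin n) (lam mu : Λ), (i, lam) ≠ (j, mu) →
      Disjoint (ball (c i + (lam : EuclideanSpace ℝ (Fin 2))) r)
        (ball (c j + (mu : EuclideanSpace ℝ (Fin 2))) r)) :
    (n : ℝ) * Real.sqrt 12 * r ^ 2 ≤ ZLattice.covolume Λ volume := by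
  let b := Module.Free.chooseBasis ℤ Λ
  have hF := ZLattice.isAddFundamentalDomain b (volume : Measure (EuclideanSpace ℝ (Fin 2)))
  rw [ZLattice.covolume_eq_measure_fundamentalDomain Λ volume hF]
  have : Countable Λ := inferInstance
  have : MeasurableVAdd Λ E2 := (inferInstance : MeasurableVAdd Λ.toAddSubgroup E2)
  have : VAddInvariantMeasure Λ E2 volume :=
    (inferInstance : VAddInvariantMeasure Λ.toAddSubgroup E2 volume)
  let P : Fin n × Λ → E2 := fun a => c a.1 + (a.2 : E2)
  have hP : ∀ a b, a ≠ b → 2 * r ≤ ‖P a - P b‖ := by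
    intro a b hab
    have := (disjoint_ball_ball_iff hr hr).1 (hdisj a.1 b.1 a.2 b.2 hab)
    rw [dist_eq_norm] at this
    linarith
  let V : Fin n × Λ → Set E2 := fun a => {x | ∀ b, b ≠ a → ‖x - P a‖ < ‖x - P b‖}
  have hVm : ∀ a, MeasurableSet (V a) := by
    intro a
    have : V a = ⋂ b, ⋂ (_ : b ≠ a), {x | ‖x - P a‖ < ‖x - P b‖} := by
      ext x; simp [V]
    rw [this]
    refine MeasurableSet.iInter fun b => MeasurableSet.iInter fun _ => ?_
    exact (isOpen_lt (by fun_prop) (by fun_prop)).measurableSet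
  have hVd : ∀ a b, a ≠ b → Disjoint (V a) (V b) := by
    intro a b hab
    rw [Set.disjoint_left]
    intro x h1 h2
    exact lt_asymm (h1 b hab.symm) (h2 a hab)
  have hVvol : ∀ a, ENNReal.ofReal (Real.sqrt 12 * r ^ 2) ≤ volume (V a) := by
    intro a
    have := cell (ι := {b // b ≠ a}) r hr (fun b => P b - P a) (fun b => hP _ _ b.2)
      (fun b b' hb => by
        have := hP b b' (fun h => hb (Subtype.ext h))
        simpa using this)
    refine this.trans_eq ?_
    rw [← measure_preimage_add_right volume (-P a)]
    congr 1
    ext x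
    simp [V, ← sub_eq_add_neg, sub_sub_sub_cancel_right]
  have hW : volume (⋃ i, V (i, 0)) = ∑ i, volume (V (i, 0)) := by
    rw [measure_iUnion, tsum_fintype]
    · intro i j hij
      exact hVd _ _ (by simpa using hij)
    · exact fun i => hVm _
  have htr : ∀ (g : Λ) (i : Fin n), ∀ x ∈ V (i, 0), (g : E2) + x ∈ V (i, g) := by
    intro g i x hx b hb
    have := hx (b.1, b.2 - g) (by
      intro h
      apply hb
      rw [Prod.ext_iff] at h ⊢
      exact ⟨h.1, sub_eq_zero.1 h.2⟩)
    simp only [P] at this ⊢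
    convert this using 2
    · push_cast; abel
    · push_cast; abel
  have hle := hF.measure_le_of_pairwise_disjoint (t := ⋃ i, V (i, 0))
    (MeasurableSet.iUnion fun i => hVm _).nullMeasurableSet (by
      refine Pairwise.aedisjoint fun g₁ g₂ hne => ?_
      refine (Disjoint.inf_left _ ?_).inf_right _
      rw [Set.disjoint_left]
      rintro _ ⟨x, hx, rfl⟩ ⟨y, hy, hxy⟩
      obtain ⟨i, hi⟩ := Set.mem_iUnion.1 hx
      obtain ⟨j, hj⟩ := Set.mem_iUnion.1 hy
      have h1 := htr g₁ i x hi
      have h2 := htr g₂ j y hj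
      have hxy' : (g₂ : E2) + y = g₁ + x := hxy
      rw [hxy'] at h2
      exact Set.disjoint_left.1 (hVd (i, g₁) (j, g₂) (by simp [hne])) h1 h2)
  rw [hW] at hle
  have hfin : volume (ZSpan.fundamentalDomain (b.ofZLatticeBasis ℝ)) ≠ ⊤ :=
    (Bornology.IsBounded.measure_lt_top (ZSpan.fundamentalDomain_isBounded _)).ne
  rw [measureReal_def, ← ENNReal.ofReal_le_iff_le_toReal hfin]
  refine le_trans ?_ hle
  calc ENNReal.ofReal (n * Real.sqrt 12 * r ^ 2)
      = ∑ i : Fin n, ENNReal.ofReal (Real.sqrt 12 * r ^ 2) := by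
        rw [Finset.sum_const, Finset.card_univ, Fintype.card_fin, nsmul_eq_mul, mul_assoc,
          ENNReal.ofReal_mul (by positivity), ENNReal.ofReal_natCast]
    _ ≤ _ := Finset.sum_le_sum fun i _ => hVvol _
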